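/- Let 0 < a < min{c,1} and 0 < b < c ≤ a+b. Then for r ∈ (0,1) the generalized complete elliptic integral 𝕂_{a,b,c} satisfies the differentiation formula: d𝕂_{a,b,c}(r)/dr = (2/(r·r'²))·((c−a)·𝔼_{a,b,c}(r) + (b·r² + a − c)·𝕂_{a,b,c}(r)), where r' = √(1−r²). -/

import Mathlib

open Filter Set

/-- Shifted factorial (Appell symbol) `(a,n) = a(a+1)⋯(a+n−1)`, with `(a,0)=1`. -/
noncomputable def shiftedFact (a : ℝ) (n : ℕ) : ℝ := ∏ i ∈ Finset.range n, (a + i)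

/-- Gaussian hypergeometric function `F(a,b;c;x)` as a real power series. -/
noncomputable def hypF (a b c x : ℝ) : ℝ :=
  ∑' n : ℕ, (shiftedFact a n * shiftedFact b n / (shiftedFact c n * (n.factorial : ℝ))) * x ^ n

/-- Beta function `B(x,y) = Γ(x)Γ(y)/Γ(x+y)`. -/
noncomputable def betaR (x y : ℝ) : ℝ := Real.Gamma x * Real.Gamma y / Real.Gamma (x + y)

/-- Generalized complete elliptic integral of the first kind `𝕂_{a,b,c}(r)`. -/
noncomputable def Kg (a b c r : ℝ) : ℝ := betaR a b / 2 * hypF a b c (r ^ 2)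

/-- Generalized complete elliptic integral of the second kind `𝔼_{a,b,c}(r)`. -/
noncomputable def Eg (a b c r : ℝ) : ℝ := betaR a b / 2 * hypF (a - 1) b c (r ^ 2)

/-- The coefficient of `x ^ n` in the Gaussian hypergeometric series `F(a,b;c;x)`. -/
noncomputable def hypCoeff (a b c : ℝ) (n : ℕ) : ℝ :=
  shiftedFact a n * shiftedFact b n / (shiftedFact c n * (n.factorial : ℝ))

lemma shiftedFact_zero (a : ℝ) : shiftedFact a 0 = 1 := by simp [shiftedFact]

lemma shiftedFact_succ (a : ℝ) (n : ℕ) :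
    shiftedFact a (n + 1) = shiftedFact a n * (a + n) := by
  simp [shiftedFact, Finset.prod_range_succ]

lemma shiftedFact_sub_one_succ (a : ℝ) (n : ℕ) :
    shiftedFact (a - 1) (n + 1) = (a - 1) * shiftedFact a n := by
  rw [shiftedFact, Finset.prod_range_succ', mul_comm, shiftedFact]
  congr 1
  · simp
  · refine Finset.prod_congr rfl fun i _ => ?_
    push_cast
    ring

lemma shiftedFact_one (n : ℕ) : shiftedFact 1 n = n.factorial := by
  induction n with
  | zero => simp [shiftedFact_zero]
  | succ n ih =>
    rw [shiftedFact_succ, ih, Nat.factorial_succ]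
    push_cast
    ring

lemma shiftedFact_pos {c : ℝ} (hc : 0 < c) (n : ℕ) : 0 < shiftedFact c n :=
  Finset.prod_pos fun i _ => by positivity

lemma abs_shiftedFact_le {a c : ℝ} (h : |a| ≤ c) (n : ℕ) :
    |shiftedFact a n| ≤ shiftedFact c n := by
  rw [shiftedFact, Finset.abs_prod]
  refine Finset.prod_le_prod (fun i _ => abs_nonneg _) fun i _ => (abs_add_le _ _).trans ?_
  rw [Nat.abs_cast]
  gcongr

lemma abs_hypCoeff_le_one {a b c : ℝ} (ha : |a| ≤ 1) (hb : |b| ≤ c) (hc : 0 < c) (n : ℕ) :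
    |hypCoeff a b c n| ≤ 1 := by
  have hpos : 0 < shiftedFact c n * (n.factorial : ℝ) :=
    mul_pos (shiftedFact_pos hc n) (by positivity)
  rw [hypCoeff, abs_div, abs_of_pos hpos, div_le_one hpos, abs_mul, mul_comm, ← shiftedFact_one]
  exact mul_le_mul (abs_shiftedFact_le hb n) (abs_shiftedFact_le ha n) (abs_nonneg _)
    (shiftedFact_pos hc n).le

/-- The contiguous relation between `F(a,b;c;·)` and `F(a-1,b;c;·)` on coefficients. -/
lemma hypCoeff_contiguous {a b c : ℝ} (hc : 0 < c) (n : ℕ) :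
    ((n + 1 : ℕ) + c - a) * hypCoeff a b c (n + 1) - (c - a) * hypCoeff (a - 1) b c (n + 1) =
      (b + n) * hypCoeff a b c n := by
  have h1 : shiftedFact c n ≠ 0 := (shiftedFact_pos hc n).ne'
  have h2 : (c + n : ℝ) ≠ 0 := by positivity
  have h3 : (n.factorial : ℝ) ≠ 0 := by positivity
  have h4 : (n + 1 : ℝ) ≠ 0 := by positivity
  rw [hypCoeff, hypCoeff, hypCoeff, shiftedFact_sub_one_succ, shiftedFact_succ, shiftedFact_succ,
    shiftedFact_succ, Nat.factorial_succ]
  push_cast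
  field_simp
  ring

lemma summable_mul_pow_of_abs_le_one {t : ℕ → ℝ} (ht : ∀ n, |t n| ≤ 1) {x : ℝ} (hx : |x| < 1) :
    Summable fun n => t n * x ^ n := by
  refine .of_norm_bounded (summable_geometric_of_lt_one (abs_nonneg x) hx) fun n => ?_
  rw [Real.norm_eq_abs, abs_mul, abs_pow]
  exact mul_le_of_le_one_left (by positivity) (ht n)

lemma summable_natCast_mul_pow_sub_one {x : ℝ} (hx : |x| < 1) :
    Summable fun n : ℕ => (n : ℝ) * x ^ (n - 1) := by
  rw [← summable_nat_add_iff 1]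
  have h1 := summable_pow_mul_geometric_of_norm_lt_one 1 (r := x) (by simpa using hx)
  have h2 := summable_geometric_of_abs_lt_one hx
  refine (h1.add h2).congr fun n => ?_
  simp only [Nat.add_sub_cancel]
  push_cast
  ring

lemma summable_mul_natCast_mul_pow_sub_one {t : ℕ → ℝ} (ht : ∀ n, |t n| ≤ 1) {x : ℝ}
    (hx : |x| < 1) : Summable fun n : ℕ => t n * (n * x ^ (n - 1)) := by
  refine .of_norm_bounded (summable_natCast_mul_pow_sub_one (x := |x|) (by simpa using hx))
    fun n => ?_
  rw [Real.norm_eq_abs, abs_mul, abs_mul, abs_pow, Nat.abs_cast]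
  exact mul_le_of_le_one_left (by positivity) (ht n)

lemma hasDerivAt_tsum_mul_pow {t : ℕ → ℝ} (ht : ∀ n, |t n| ≤ 1) {x : ℝ} (hx : |x| < 1) :
    HasDerivAt (fun y => ∑' n, t n * y ^ n) (∑' n : ℕ, t n * (n * x ^ (n - 1))) x := by
  obtain ⟨ρ, hxρ, hρ⟩ := exists_between hx
  have hρ0 : 0 < ρ := (abs_nonneg x).trans_lt hxρ
  have hu := summable_natCast_mul_pow_sub_one (x := ρ) (by rwa [abs_of_pos hρ0])
  refine hasDerivAt_tsum_of_isPreconnected (t := Metric.ball (0 : ℝ) ρ) (y₀ := 0) hu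
    Metric.isOpen_ball (convex_ball 0 ρ).isPreconnected
    (fun n y _ => (hasDerivAt_pow n y).const_mul (t n)) (fun n y hy => ?_)
    (Metric.mem_ball_self hρ0) (summable_mul_pow_of_abs_le_one ht (by simp)) (by simpa using hxρ)
  have hy' : |y| ≤ ρ := by simpa using (mem_ball_zero_iff.mp hy).le
  rw [Real.norm_eq_abs, abs_mul, abs_mul, abs_pow, Nat.abs_cast]
  refine (mul_le_of_le_one_left (by positivity) (ht n)).trans ?_
  gcongr

/-- The derivative of `F(a,b;c;·)` in terms of `F(a,b;c;·)` and `F(a-1,b;c;·)`. -/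
lemma exists_hasDerivAt_hypF {a b c x : ℝ} (ha : |a| ≤ 1) (ha' : |a - 1| ≤ 1) (hb : |b| ≤ c)
    (hc : 0 < c) (hx : |x| < 1) :
    ∃ D, HasDerivAt (hypF a b c) D x ∧
      x * (1 - x) * D = (c - a) * hypF (a - 1) b c x + (b * x + a - c) * hypF a b c x := by
  have ht := abs_hypCoeff_le_one ha hb hc
  refine ⟨_, hasDerivAt_tsum_mul_pow ht hx, ?_⟩
  have hF : HasSum (fun n => hypCoeff a b c n * x ^ n) (hypF a b c x) :=
    (summable_mul_pow_of_abs_le_one ht hx).hasSum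
  have hE : HasSum (fun n => hypCoeff (a - 1) b c n * x ^ n) (hypF (a - 1) b c x) :=
    (summable_mul_pow_of_abs_le_one (abs_hypCoeff_le_one ha' hb hc) hx).hasSum
  have hD := (summable_mul_natCast_mul_pow_sub_one ht hx).hasSum
  set D := ∑' n : ℕ, hypCoeff a b c n * (n * x ^ (n - 1))
  have hxD : HasSum (fun n : ℕ => n * hypCoeff a b c n * x ^ n) (x * D) := by
    refine (hD.mul_left x).congr_fun fun n => ?_
    rcases n with _ | n
    · simp
    · simp only [Nat.add_sub_cancel]
      ring
  have hL := (hxD.add (hF.mul_left (c - a))).sub (hE.mul_left (c - a))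
  have hR := ((hF.mul_left b).add hxD).mul_left x
  rw [← hasSum_nat_add_iff' 1] at hL
  have key := hL.unique (hR.congr_fun fun n => ?_)
  · simp [hypCoeff, shiftedFact_zero] at key
    linear_combination key
  · linear_combination x ^ (n + 1) * hypCoeff_contiguous (a := a) (b := b) hc n

theorem stmt13 (a b c : ℝ) (ha : 0 < a) (ha' : a < min c 1)
    (hb : 0 < b) (hbc : b < c) (hcab : c ≤ a + b) :
    ∀ r ∈ Set.Ioo (0 : ℝ) 1,
      deriv (fun t => Kg a b c t) r =
        (2 / (r * (1 - r ^ 2))) *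
          ((c - a) * Eg a b c r + (b * r ^ 2 + a - c) * Kg a b c r) := by
  rintro r ⟨hr0, hr1⟩
  have ha1 : a < 1 := ha'.trans_le (min_le_right _ _)
  have hr2 : r ^ 2 < 1 := by nlinarith
  obtain ⟨D, hD, hrel⟩ := exists_hasDerivAt_hypF (a := a) (b := b) (c := c) (x := r ^ 2)
    (abs_le.mpr ⟨by linarith, ha1.le⟩) (abs_le.mpr ⟨by linarith, by linarith⟩)
    (by rw [abs_of_pos hb]; exact hbc.le) (hb.trans hbc) (by rwa [abs_of_nonneg (sq_nonneg r)])
  have hK : HasDerivAt (fun t => Kg a b c t) (betaR a b / 2 * (D * (2 * r))) r := by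
    have hsq : HasDerivAt (fun t : ℝ => t ^ 2) (2 * r) r := by simpa using hasDerivAt_pow 2 r
    exact (HasDerivAt.comp (h := fun t : ℝ => t ^ 2) r hD hsq).const_mul _
  have hne : 1 - r ^ 2 ≠ 0 := by linarith
  rw [hK.deriv, Kg, Eg, div_mul_eq_mul_div 2, eq_div_iff (mul_ne_zero hr0.ne' hne)]
  linear_combination betaR a b * hrel
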